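/- For every e ∈ [0,1) and every ℓ ∈ ℝ, Kepler's equation u − e·sin(u) = ℓ has a unique real solution u(e,ℓ); for each fixed e ∈ [0,1) the map u ↦ u − e·sin(u) is a strictly increasing bijection of ℝ; the solution map (e,ℓ) ↦ u(e,ℓ) is C^∞ on [0,1) × ℝ; it satisfies ∂u/∂ℓ (e,ℓ) = 1/(1 − e·cos(u(e,ℓ))); and u(e, ℓ + 2π) = u(e,ℓ) + 2π for all (e,ℓ). -/

import Mathlib

lemma kepler_pos {e : ℝ} (he : |e| < 1) (u : ℝ) : 0 < 1 - e * Real.cos u := by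
  have h1 : |e * Real.cos u| < 1 := by
    rw [abs_mul]
    have := Real.abs_cos_le_one u
    nlinarith [abs_nonneg e, abs_nonneg (Real.cos u)]
  have := (abs_lt.mp h1).2
  linarith

lemma kepler_hasDerivAt (e u : ℝ) :
    HasDerivAt (fun u : ℝ => u - e * Real.sin u) (1 - e * Real.cos u) u :=
  (hasDerivAt_id u).sub ((Real.hasDerivAt_sin u).const_mul e)

lemma kepler_strictMono {e : ℝ} (he : |e| < 1) :
    StrictMono (fun u : ℝ => u - e * Real.sin u) := by
  apply strictMono_of_deriv_pos
  intro u
  rw [(kepler_hasDerivAt e u).deriv]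
  exact kepler_pos he u

lemma kepler_surj {e : ℝ} (he : |e| < 1) :
    Function.Surjective (fun u : ℝ => u - e * Real.sin u) := by
  intro l
  have hb : ∀ u, |e * Real.sin u| ≤ 1 := by
    intro u
    rw [abs_mul]
    have := Real.abs_sin_le_one u
    nlinarith [abs_nonneg e, abs_nonneg (Real.sin u)]
  have hc : ContinuousOn (fun u : ℝ => u - e * Real.sin u) (Set.Icc (l - 1) (l + 1)) := by
    fun_prop
  have h := intermediate_value_Icc (by linarith) hc
  have hl : l ∈ Set.Icc ((l - 1) - e * Real.sin (l - 1)) ((l + 1) - e * Real.sin (l + 1)) := by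
    have h1 := abs_le.mp (hb (l - 1))
    have h2 := abs_le.mp (hb (l + 1))
    constructor <;> linarith [h1.1, h2.2]
  obtain ⟨u, -, hu⟩ := h hl
  exact ⟨u, hu⟩

/-- The eccentric anomaly. -/
noncomputable def keplerU (e l : ℝ) : ℝ :=
  Function.invFun (fun u : ℝ => u - e * Real.sin u) l

lemma keplerU_spec {e : ℝ} (he : |e| < 1) (l : ℝ) :
    keplerU e l - e * Real.sin (keplerU e l) = l :=
  Function.invFun_eq (f := fun u : ℝ => u - e * Real.sin u) (kepler_surj he l)

lemma keplerU_unique {e : ℝ} (he : |e| < 1) {l u : ℝ} (h : u - e * Real.sin u = l) :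
    u = keplerU e l :=
  (kepler_strictMono he).injective (by simpa only [keplerU_spec he l] using h)

lemma keplerU_contDiffAt {e : ℝ} (he : |e| < 1) (l : ℝ) :
    ContDiffAt ℝ (⊤ : ℕ∞) (fun p : ℝ × ℝ => keplerU p.1 p.2) (e, l) := by
  let f : (ℝ × ℝ) × ℝ → ℝ := fun q => q.2 - q.1.1 * Real.sin q.2 - q.1.2
  let v : (ℝ × ℝ) × ℝ := ((e, l), keplerU e l)
  have cdf : ContDiffAt ℝ (⊤ : ℕ∞) f v := by
    apply ContDiff.contDiffAt
    fun_prop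
  have pn : (((⊤ : ℕ∞) : WithTop ℕ∞)) ≠ 0 := by simp
  have hfv : f v = 0 := by
    have := keplerU_spec he l
    simp only [f, v]
    linarith
  have hd : HasFDerivAt f (fderiv ℝ f v) v :=
    (cdf.differentiableAt pn).hasFDerivAt
  have hcomp : HasDerivAt (fun u : ℝ => f ((e, l), u))
      ((fderiv ℝ f v) ((0 : ℝ × ℝ), (1 : ℝ))) (keplerU e l) :=
    HasFDerivAt.comp_hasDerivAt (keplerU e l) hd
      ((hasDerivAt_const (keplerU e l) ((e, l) : ℝ × ℝ)).prodMk (hasDerivAt_id (keplerU e l)))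
  have hval : (fderiv ℝ f v) ((0 : ℝ × ℝ), (1 : ℝ)) = 1 - e * Real.cos (keplerU e l) :=
    hcomp.unique ((kepler_hasDerivAt e (keplerU e l)).sub_const l)
  have hne := (kepler_pos he (keplerU e l)).ne'
  have if₂ : (fderiv ℝ f v ∘L .inr ℝ (ℝ × ℝ) ℝ).IsInvertible := by
    refine ⟨ContinuousLinearEquiv.unitsEquivAut ℝ (Units.mk0 _ hne), ?_⟩
    ext
    simp [hval]
  have hev := cdf.eventually_apply_implicitFunction pn if₂
  have hcd := cdf.contDiffAt_implicitFunction pn if₂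
  refine hcd.congr_of_eventuallyEq ?_
  have hopen : ∀ᶠ p : ℝ × ℝ in nhds (e, l), |p.1| < 1 :=
    (isOpen_lt (by fun_prop : Continuous fun p : ℝ × ℝ => |p.1|) continuous_const).mem_nhds he
  filter_upwards [hev, hopen] with p hp hp1
  rw [hfv] at hp
  symm
  apply keplerU_unique hp1
  simp only [f] at hp
  linarith

lemma keplerU_hasDerivAt {e : ℝ} (he : |e| < 1) (l : ℝ) :
    HasDerivAt (fun l : ℝ => keplerU e l) (1 / (1 - e * Real.cos (keplerU e l))) l := by
  have hdiff : DifferentiableAt ℝ (fun l : ℝ => keplerU e l) l := by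
    have h := (keplerU_contDiffAt he l).differentiableAt (by simp)
    exact DifferentiableAt.comp (f := fun l : ℝ => ((e, l) : ℝ × ℝ)) l h (by fun_prop)
  have h1 := hdiff.hasDerivAt
  have h2 := (kepler_hasDerivAt e (keplerU e l)).comp l h1
  have h3 : ((fun u : ℝ => u - e * Real.sin u) ∘ fun l => keplerU e l) = id := by
    funext x
    exact keplerU_spec he x
  rw [h3] at h2
  have h4 := h2.unique (hasDerivAt_id l)
  have hne := (kepler_pos he (keplerU e l)).ne'
  have h5 : deriv (fun l : ℝ => keplerU e l) l = 1 / (1 - e * Real.cos (keplerU e l)) := by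
    rw [eq_div_iff hne]
    linarith
  rwa [h5] at h1

/-- For every `e ∈ [0,1)` and every `ℓ ∈ ℝ`, Kepler's equation
`u − e·sin u = ℓ` has a unique real solution; for each fixed `e ∈ [0,1)` the map
`u ↦ u − e·sin u` is a strictly increasing bijection of `ℝ`; the solution map
`(e,ℓ) ↦ u(e,ℓ)` is `C^∞` on `[0,1) × ℝ`, satisfies
`∂u/∂ℓ = 1/(1 − e·cos(u(e,ℓ)))`, and `u(e, ℓ + 2π) = u(e,ℓ) + 2π`. -/
theorem stmt_0 :
    (∀ e ∈ Set.Ico (0:ℝ) 1, ∀ ℓ : ℝ, ∃! u : ℝ, u - e * Real.sin u = ℓ) ∧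
    (∀ e ∈ Set.Ico (0:ℝ) 1,
      StrictMono (fun u : ℝ => u - e * Real.sin u) ∧
      Function.Bijective (fun u : ℝ => u - e * Real.sin u)) ∧
    (∃ U : ℝ → ℝ → ℝ,
      (∀ e ∈ Set.Ico (0:ℝ) 1, ∀ ℓ : ℝ, U e ℓ - e * Real.sin (U e ℓ) = ℓ) ∧
      ContDiffOn ℝ (⊤ : ℕ∞) (fun p : ℝ × ℝ => U p.1 p.2)
        (Set.Ico (0:ℝ) 1 ×ˢ (Set.univ : Set ℝ)) ∧
      (∀ e ∈ Set.Ico (0:ℝ) 1, ∀ ℓ : ℝ,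
        HasDerivAt (fun l : ℝ => U e l) (1 / (1 - e * Real.cos (U e ℓ))) ℓ) ∧
      (∀ e ∈ Set.Ico (0:ℝ) 1, ∀ ℓ : ℝ,
        U e (ℓ + 2 * Real.pi) = U e ℓ + 2 * Real.pi)) := by
  have key : ∀ e ∈ Set.Ico (0:ℝ) 1, |e| < 1 := fun e he => by
    rw [abs_of_nonneg he.1]; exact he.2
  refine ⟨fun e he l => ⟨keplerU e l, keplerU_spec (key e he) l,
      fun u hu => keplerU_unique (key e he) hu⟩,
    fun e he => ⟨kepler_strictMono (key e he), (kepler_strictMono (key e he)).injective,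
      kepler_surj (key e he)⟩,
    keplerU, fun e he l => keplerU_spec (key e he) l, ?_,
    fun e he l => keplerU_hasDerivAt (key e he) l, ?_⟩
  · rintro ⟨e, l⟩ ⟨he, -⟩
    exact (keplerU_contDiffAt (key e he) l).contDiffWithinAt
  · intro e he l
    symm
    apply keplerU_unique (key e he)
    rw [Real.sin_add_two_pi]
    linarith [keplerU_spec (key e he) l]
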